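/- Let p > 1 and let Ω ⊂ ℝ^N be a bounded open set. Let ρ : Ω → [0, ∞) be bounded, let f satisfy condition (C) with s ↦ f(s)^{−1/(p−1)} integrable on (0, a) for every a ∈ (0, a_f), and assume ‖F‖_∞ := ∫₀^{a_f} f(s)^{−1/(p−1)} ds < ∞. Assume 0 < S := sup_{x∈Ω} ρ_x(d_Ω(x))·d_Ω(x)^p < ∞ and λ > (p/(p−1))^{p−1}·N·‖F‖_∞^{p−1}/S. Then there is no function u : cl(Ω) → ℝ that is continuous on cl(Ω), C¹ on Ω with 0 < u(x) < a_f for x ∈ Ω and u = 0 on ∂Ω, whose flux V_u is continuously differentiable on Ω with div V_u(x) ≤ −λ·ρ(x)·f(u(x)) for all x ∈ Ω. -/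

import Mathlib

open Real Set Metric MeasureTheory

/-- The "flux" of `u` at `x`: `‖∇u(x)‖^(p-2) ∇u(x)` (equal to `0` when `∇u(x) = 0`,
by the junk-value conventions of `Real.rpow`, since `p ≠ 2` gives `0 ^ (p-2) = 0` and
for `p = 2` the scalar multiplies the zero vector). -/
noncomputable def flux {N : ℕ} (p : ℝ) (u : EuclideanSpace ℝ (Fin N) → ℝ)
    (x : EuclideanSpace ℝ (Fin N)) : EuclideanSpace ℝ (Fin N) :=
  ‖gradient u x‖ ^ (p - 2) • gradient u x

/-- The divergence of a vector field `V` at `x`: `∑ i, ∂V_i/∂x_i (x)`. -/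
noncomputable def pdiv {N : ℕ} (V : EuclideanSpace ℝ (Fin N) → EuclideanSpace ℝ (Fin N))
    (x : EuclideanSpace ℝ (Fin N)) : ℝ :=
  ∑ i : Fin N, fderiv ℝ V x (EuclideanSpace.single i 1) i

open Topology

/-- The square of the positive part is `C¹`, with derivative twice the positive part. -/
lemma contDiff_one_max_zero_sq : ContDiff ℝ 1 (fun s : ℝ => max s 0 ^ 2) ∧
    ∀ s : ℝ, HasDerivAt (fun s : ℝ => max s 0 ^ 2) (2 * max s 0) s := by
  have key : ∀ s : ℝ, HasDerivAt (fun s : ℝ => max s 0 ^ 2) (2 * max s 0) s := by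
    intro s
    rcases lt_trichotomy s 0 with h | rfl | h
    · rw [max_eq_right h.le, mul_zero]
      refine (hasDerivAt_const s (0 : ℝ)).congr_of_eventuallyEq ?_
      filter_upwards [Iio_mem_nhds h] with t ht
      simp [max_eq_right (le_of_lt (mem_Iio.1 ht))]
    · rw [max_self, mul_zero, hasDerivAt_iff_isLittleO_nhds_zero]
      have h1 : (fun h : ℝ => h ^ 2) =o[𝓝 0] (fun h : ℝ => h) := by
        simpa using Asymptotics.isLittleO_pow_pow (𝕜 := ℝ) (m := 1) (n := 2) (by norm_num)
      refine Asymptotics.IsBigO.trans_isLittleO (Asymptotics.isBigO_of_le _ fun t => ?_) h1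
      rcases le_total t 0 with ht | ht <;> simp [ht, sq_nonneg]
    · rw [max_eq_left h.le]
      have h2 : HasDerivAt (fun t : ℝ => t ^ 2) (2 * s) s := by
        simpa using hasDerivAt_pow 2 s
      refine h2.congr_of_eventuallyEq ?_
      filter_upwards [Ioi_mem_nhds h] with t ht
      simp [max_eq_left (le_of_lt (mem_Ioi.1 ht))]
  refine ⟨contDiff_one_iff_deriv.2 ⟨fun s => (key s).differentiableAt, ?_⟩, key⟩
  rw [funext fun s => (key s).deriv]
  fun_prop

/-- The map `a ↦ ‖a‖ ^ (p - 2) • a` is monotone. -/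
lemma inner_norm_rpow_smul_sub_nonneg {E : Type*} [NormedAddCommGroup E] [InnerProductSpace ℝ E]
    {p : ℝ} (hp : 1 < p) (a b : E) :
    0 ≤ inner ℝ (a - b) (‖a‖ ^ (p - 2) • a - ‖b‖ ^ (p - 2) • b) := by
  have hpow : ∀ c : E, ‖c‖ ^ (p - 2) * ‖c‖ = ‖c‖ ^ (p - 1) := fun c => by
    rw [show p - 1 = p - 2 + 1 by ring,
      Real.rpow_add_one' (norm_nonneg c) (by linarith)]
  have hab : inner ℝ a b ≤ ‖a‖ * ‖b‖ := real_inner_le_norm a b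
  have ha := Real.rpow_nonneg (norm_nonneg a) (p - 2)
  have hb := Real.rpow_nonneg (norm_nonneg b) (p - 2)
  have hmono : 0 ≤ (‖a‖ - ‖b‖) * (‖a‖ ^ (p - 1) - ‖b‖ ^ (p - 1)) := by
    rcases le_total ‖a‖ ‖b‖ with h | h
    · exact mul_nonneg_of_nonpos_of_nonpos (sub_nonpos.2 h)
        (sub_nonpos.2 (Real.rpow_le_rpow (norm_nonneg a) h (by linarith)))
    · exact mul_nonneg (sub_nonneg.2 h)
        (sub_nonneg.2 (Real.rpow_le_rpow (norm_nonneg b) h (by linarith)))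
  rw [← hpow, ← hpow] at hmono
  simp only [inner_sub_left, inner_sub_right, inner_smul_right, real_inner_self_eq_norm_sq,
    real_inner_comm a b]
  nlinarith [mul_le_mul_of_nonneg_left hab ha, mul_le_mul_of_nonneg_left hab hb,
    real_inner_comm a b]

section Divergence

variable {N : ℕ}

lemma pdiv_smul {φ : EuclideanSpace ℝ (Fin N) → ℝ}
    {Z : EuclideanSpace ℝ (Fin N) → EuclideanSpace ℝ (Fin N)} {x : EuclideanSpace ℝ (Fin N)}
    (hφ : DifferentiableAt ℝ φ x) (hZ : DifferentiableAt ℝ Z x) :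
    pdiv (fun y => φ y • Z y) x = φ x * pdiv Z x + fderiv ℝ φ x (Z x) := by
  have hsum : Z x = ∑ i, Z x i • EuclideanSpace.single i (1 : ℝ) := by
    ext j
    simp [Finset.sum_apply, Pi.single_apply]
  conv_rhs => rw [hsum]
  simp only [pdiv, fderiv_fun_smul hφ hZ, map_sum, map_smul, Finset.mul_sum,
    ← Finset.sum_add_distrib]
  refine Finset.sum_congr rfl fun i _ => ?_
  simp [mul_comm]

lemma pdiv_sub {V W : EuclideanSpace ℝ (Fin N) → EuclideanSpace ℝ (Fin N)}
    {x : EuclideanSpace ℝ (Fin N)} (hV : DifferentiableAt ℝ V x) (hW : DifferentiableAt ℝ W x) :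
    pdiv (fun y => V y - W y) x = pdiv V x - pdiv W x := by
  simp [pdiv, fderiv_fun_sub hV hW, Finset.sum_sub_distrib]

lemma continuous_pdiv {G : EuclideanSpace ℝ (Fin N) → EuclideanSpace ℝ (Fin N)}
    (hG : ContDiff ℝ 1 G) : Continuous (pdiv G) := by
  have := hG.continuous_fderiv one_ne_zero
  unfold pdiv
  fun_prop

lemma hasCompactSupport_pdiv {G : EuclideanSpace ℝ (Fin N) → EuclideanSpace ℝ (Fin N)}
    (hc : HasCompactSupport G) : HasCompactSupport (pdiv G) :=
  (hc.fderiv ℝ).comp_left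
    (g := fun A : EuclideanSpace ℝ (Fin N) →L[ℝ] EuclideanSpace ℝ (Fin N) =>
      ∑ i : Fin N, A (EuclideanSpace.single i 1) i) (by simp)

/-- Divergence theorem for compactly supported fields. -/
lemma integral_pdiv_eq_zero {G : EuclideanSpace ℝ (Fin N) → EuclideanSpace ℝ (Fin N)}
    (hG : ContDiff ℝ 1 G) (hc : HasCompactSupport G) : ∫ x, pdiv G x = 0 := by
  have hcont := hG.continuous_fderiv one_ne_zero
  have hG' := hG.differentiable one_ne_zero
  have hint : ∀ i : Fin N,
      Integrable (fun x => fderiv ℝ G x (EuclideanSpace.single i 1) i) := fun i =>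
    Continuous.integrable_of_hasCompactSupport (by fun_prop)
      ((hc.fderiv ℝ).comp_left
        (g := fun A : EuclideanSpace ℝ (Fin N) →L[ℝ] EuclideanSpace ℝ (Fin N) =>
          A (EuclideanSpace.single i 1) i) (by simp))
  unfold pdiv
  rw [integral_finsetSum _ fun i _ => hint i]
  refine Finset.sum_eq_zero fun i _ => ?_
  have hGi : Differentiable ℝ (fun x => G x i) := by fun_prop
  have hfd : ∀ x, fderiv ℝ (fun x => G x i) x (EuclideanSpace.single i 1)
      = fderiv ℝ G x (EuclideanSpace.single i 1) i := fun x => by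
    have h := ((EuclideanSpace.proj i : EuclideanSpace ℝ (Fin N) →L[ℝ] ℝ).hasFDerivAt).comp x
      (hG' x).hasFDerivAt
    have h2 : fderiv ℝ (fun x => G x i) x = _ := h.fderiv
    rw [h2]
    simp
  have hGc := hG.continuous
  have hGint : Integrable (fun x => G x i) :=
    Continuous.integrable_of_hasCompactSupport (by fun_prop)
      (hc.comp_left (g := fun y : EuclideanSpace ℝ (Fin N) => y i) (by simp))
  have := integral_mul_fderiv_eq_neg_fderiv_mul_of_integrable (𝕜 := ℝ) (μ := volume)
    (f := fun _ : EuclideanSpace ℝ (Fin N) => (1 : ℝ)) (g := fun x => G x i)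
    (v := EuclideanSpace.single i 1) (by simp)
    (by simpa [hfd] using hint i) (by simpa using hGint) (fun _ _ => by fun_prop)
    (fun x _ => hGi x)
  simpa [hfd] using this

/-- Weak comparison principle for the `p`-Laplacian, for functions with `C¹` flux. -/
lemma le_of_pdiv_flux_lt {p : ℝ} (hp : 1 < p) {B K : Set (EuclideanSpace ℝ (Fin N))}
    (hB : IsOpen B) (hK : IsCompact K) (hKB : K ⊆ B)
    {v w : EuclideanSpace ℝ (Fin N) → ℝ} (hv : ContDiffOn ℝ 1 v B) (hw : ContDiffOn ℝ 1 w B)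
    (hV : ContDiffOn ℝ 1 (flux p v) B) (hW : ContDiffOn ℝ 1 (flux p w) B)
    (hdiv : ∀ x ∈ B, pdiv (flux p v) x < pdiv (flux p w) x)
    (hbd : ∀ x ∈ B, x ∉ K → w x ≤ v x) : ∀ x ∈ B, w x ≤ v x := by
  obtain ⟨hsq, hsq'⟩ := contDiff_one_max_zero_sq
  set φ : EuclideanSpace ℝ (Fin N) → ℝ := fun y => max (w y - v y) 0 ^ 2 with hφdef
  set Z : EuclideanSpace ℝ (Fin N) → EuclideanSpace ℝ (Fin N) :=
    fun y => flux p v y - flux p w y with hZdef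
  set G : EuclideanSpace ℝ (Fin N) → EuclideanSpace ℝ (Fin N) :=
    B.indicator (fun y => φ y • Z y) with hGdef
  have hφ : ContDiffOn ℝ 1 φ B := hsq.comp_contDiffOn (hw.sub hv)
  have hZ : ContDiffOn ℝ 1 Z B := hV.sub hW
  have hGB : ∀ x ∈ B, G =ᶠ[𝓝 x] fun y => φ y • Z y := fun x hx => by
    filter_upwards [hB.mem_nhds hx] with y hy
    exact indicator_of_mem hy _
  have hGK : ∀ x, x ∉ K → G x = 0 := fun x hx => by
    by_cases hxB : x ∈ B
    · have h0 : φ x = 0 := by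
        simp only [hφdef]
        rw [max_eq_right (sub_nonpos.2 (hbd x hxB hx))]
        norm_num
      rw [hGdef, indicator_of_mem hxB, h0, zero_smul]
    · exact indicator_of_notMem hxB _
  have hGK' : ∀ x, x ∉ K → G =ᶠ[𝓝 x] fun _ => 0 := fun x hx => by
    filter_upwards [hK.isClosed.isOpen_compl.mem_nhds hx] with y hy
    exact hGK y hy
  have hG : ContDiff ℝ 1 G := by
    rw [contDiff_iff_contDiffAt]
    intro x
    by_cases hx : x ∈ K
    · exact (((hφ.smul hZ).contDiffAt (hB.mem_nhds (hKB hx))).congr_of_eventuallyEq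
        (hGB x (hKB hx)))
    · exact contDiffAt_const.congr_of_eventuallyEq (hGK' x hx)
  have hc : HasCompactSupport G := HasCompactSupport.intro hK fun x hx => hGK x hx
  have hval : ∀ x ∈ B, pdiv G x ≤ φ x * (pdiv (flux p v) x - pdiv (flux p w) x) := by
    intro x hx
    have hn := hB.mem_nhds hx
    have hvx := (hv.contDiffAt hn).differentiableAt one_ne_zero
    have hwx := (hw.contDiffAt hn).differentiableAt one_ne_zero
    have e1 : pdiv G x = pdiv (fun y => φ y • Z y) x := by
      simp only [pdiv, (hGB x hx).fderiv_eq]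
    have hφ' : HasFDerivAt φ ((2 * max (w x - v x) 0) • (fderiv ℝ w x - fderiv ℝ v x)) x :=
      (hsq' (w x - v x)).comp_hasFDerivAt (f := fun y => w y - v y) x
        (hwx.hasFDerivAt.fun_sub hvx.hasFDerivAt)
    rw [e1, pdiv_smul hφ'.differentiableAt ((hZ.contDiffAt hn).differentiableAt one_ne_zero),
      hφ'.fderiv, pdiv_sub ((hV.contDiffAt hn).differentiableAt one_ne_zero)
        ((hW.contDiffAt hn).differentiableAt one_ne_zero)]
    have e2 : (fderiv ℝ w x - fderiv ℝ v x) (Z x)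
        = -inner ℝ (gradient w x - gradient v x) (flux p w x - flux p v x) := by
      rw [← toDual_gradient, ← toDual_gradient, ← map_sub, InnerProductSpace.toDual_apply_apply,
        ← inner_neg_right, neg_sub]
    have e3 := inner_norm_rpow_smul_sub_nonneg hp (gradient w x) (gradient v x)
    have e4 : 0 ≤ 2 * max (w x - v x) 0 := by positivity
    have e5 := mul_nonneg e4 e3
    rw [smul_apply, e2, smul_eq_mul]
    simp only [flux] at e5 ⊢
    linarith
  have hle : ∀ x, pdiv G x ≤ 0 := by
    intro x
    by_cases hx : x ∈ K
    · exact (hval x (hKB hx)).trans (mul_nonpos_of_nonneg_of_nonpos (sq_nonneg _)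
        (sub_nonpos.2 (hdiv x (hKB hx)).le))
    · simp [pdiv, (hGK' x hx).fderiv_eq]
  intro x hx
  by_contra! hlt
  have hneg : pdiv G x < 0 := by
    refine (hval x hx).trans_lt (mul_neg_of_pos_of_neg ?_ (sub_neg.2 (hdiv x hx)))
    have : 0 < max (w x - v x) 0 := lt_max_of_lt_left (sub_pos.2 hlt)
    positivity
  have hpos := Continuous.integral_pos_of_hasCompactSupport_nonneg_nonzero (μ := volume)
    (f := fun y => -pdiv G y) (x := x)
    (continuous_pdiv hG).neg
    ((hasCompactSupport_pdiv hc).comp_left (g := fun t : ℝ => -t) (by simp))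
    (fun y => neg_nonneg.2 (hle y)) (neg_ne_zero.2 hneg.ne)
  rw [integral_neg, integral_pdiv_eq_zero hG hc] at hpos
  simp at hpos

/-- Flux of the radial profile `a (r ^ q - ‖x - x₀‖ ^ q)`, `q = p / (p - 1)`. -/
lemma flux_torsion {p : ℝ} (hp : 1 < p) {m : ℝ} (hm : 0 < m) (c : ℝ)
    (x₀ x : EuclideanSpace ℝ (Fin N)) :
    flux p (fun y => m ^ (1 / (p - 1)) * ((p - 1) / p) * (c - ‖y - x₀‖ ^ (p / (p - 1)))) x
      = (-m) • (x - x₀) := by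
  have hp1 : 0 < p - 1 := by linarith
  have hq : 1 < p / (p - 1) := by rw [lt_div_iff₀ hp1]; linarith
  have hg : HasGradientAt
      (fun y => m ^ (1 / (p - 1)) * ((p - 1) / p) * (c - ‖y - x₀‖ ^ (p / (p - 1))))
      ((-(m ^ (1 / (p - 1)) * ‖x - x₀‖ ^ (p / (p - 1) - 2))) • (x - x₀)) x := by
    rw [hasGradientAt_iff_hasFDerivAt]
    have h1 := (hasFDerivAt_norm_rpow (x - x₀) hq).comp x ((hasFDerivAt_id x).sub_const x₀)
    have h2 := (h1.const_sub c).const_mul (m ^ (1 / (p - 1)) * ((p - 1) / p))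
    convert! h2 using 1
    ext y
    simp only [map_smul, smul_apply, neg_apply, InnerProductSpace.toDual_apply_apply, smul_eq_mul,
      ContinuousLinearMap.comp_id, innerSL_apply_apply]
    field_simp
  rw [flux, hg.gradient]
  rcases eq_or_ne x x₀ with rfl | hx
  · simp
  have hn : 0 < ‖x - x₀‖ := norm_pos_iff.2 (sub_ne_zero.2 hx)
  have hmp : 0 < m ^ (1 / (p - 1)) := Real.rpow_pos_of_pos hm _
  have hnorm : ‖(-(m ^ (1 / (p - 1)) * ‖x - x₀‖ ^ (p / (p - 1) - 2))) • (x - x₀)‖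
      = (m * ‖x - x₀‖) ^ (1 / (p - 1)) := by
    have hpos : 0 < m ^ (1 / (p - 1)) * ‖x - x₀‖ ^ (p / (p - 1) - 2) := by positivity
    rw [norm_smul, norm_neg, Real.norm_of_nonneg hpos.le, Real.mul_rpow hm.le hn.le, mul_assoc,
      ← Real.rpow_add_one hn.ne']
    congr 2
    field_simp
    ring
  rw [hnorm, smul_smul, ← Real.rpow_mul (by positivity), mul_neg, Real.mul_rpow hm.le hn.le]
  congr 2
  rw [mul_mul_mul_comm, ← Real.rpow_add hm, ← Real.rpow_add hn]
  have e1 : 1 / (p - 1) * (p - 2) + 1 / (p - 1) = 1 := by field_simp; ring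
  have e2 : 1 / (p - 1) * (p - 2) + (p / (p - 1) - 2) = 0 := by field_simp; ring
  rw [e1, e2, Real.rpow_one, Real.rpow_zero, mul_one]

lemma pdiv_smul_sub_const (a : ℝ) (x₀ x : EuclideanSpace ℝ (Fin N)) :
    pdiv (fun y => a • (y - x₀)) x = a * N := by
  have h : HasFDerivAt (fun y : EuclideanSpace ℝ (Fin N) => a • (y - x₀))
      (a • ContinuousLinearMap.id ℝ (EuclideanSpace ℝ (Fin N))) x :=
    ((hasFDerivAt_id x).sub_const x₀).const_smul a
  simp [pdiv, h.fderiv, mul_comm]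

lemma flux_comp {p : ℝ} {F : ℝ → ℝ} {u : EuclideanSpace ℝ (Fin N) → ℝ}
    {x : EuclideanSpace ℝ (Fin N)} {c : ℝ} (hc : 0 < c) (hF : HasDerivAt F c (u x))
    (hu : DifferentiableAt ℝ u x) :
    flux p (fun y => F (u y)) x = c ^ (p - 1) • flux p u x := by
  have hg : HasGradientAt (fun y => F (u y)) (c • gradient u x) x := by
    rw [hasGradientAt_iff_hasFDerivAt, map_smul]
    rw [toDual_gradient]
    exact hF.comp_hasFDerivAt x hu.hasFDerivAt
  rw [flux, flux, hg.gradient, norm_smul, Real.norm_of_nonneg hc.le,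
    Real.mul_rpow hc.le (norm_nonneg _), smul_smul, smul_smul,
    show p - 1 = p - 2 + 1 by ring, Real.rpow_add_one hc.ne']
  congr 1
  ring

/-- Torsion-type lower bound at the centre of a ball for supersolutions of `-Δ_p v ≥ μ`. -/
lemma le_center_of_pdiv_flux_le {p : ℝ} (hp : 1 < p) (hN : 1 ≤ N)
    {x₀ : EuclideanSpace ℝ (Fin N)} {r R μ μ' : ℝ} (hr : 0 < r) (hrR : r < R) (hμ' : 0 < μ')
    (hμ : μ' < μ) {v : EuclideanSpace ℝ (Fin N) → ℝ} (hv : ContDiffOn ℝ 1 v (ball x₀ R))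
    (hV : ContDiffOn ℝ 1 (flux p v) (ball x₀ R)) (hv0 : ∀ x ∈ ball x₀ R, 0 ≤ v x)
    (hdiv : ∀ x ∈ ball x₀ R, pdiv (flux p v) x ≤ -μ) :
    (μ' / N) ^ (1 / (p - 1)) * ((p - 1) / p) * r ^ (p / (p - 1)) ≤ v x₀ := by
  have hp1 : 0 < p - 1 := by linarith
  have hq : 1 < p / (p - 1) := by rw [lt_div_iff₀ hp1]; linarith
  have hN0 : (0 : ℝ) < N := by exact_mod_cast hN
  have hm : 0 < μ' / N := by positivity
  have hflux := funext (flux_torsion hp hm (r ^ (p / (p - 1))) x₀)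
  have h := le_of_pdiv_flux_lt hp (isOpen_ball (x := x₀) (ε := R)) (isCompact_closedBall x₀ r)
    (closedBall_subset_ball hrR) hv
    (w := fun y => (μ' / N) ^ (1 / (p - 1)) * ((p - 1) / p) *
      (r ^ (p / (p - 1)) - ‖y - x₀‖ ^ (p / (p - 1))))
    (by
      have := ContDiff.norm_rpow (f := fun y : EuclideanSpace ℝ (Fin N) => y - x₀)
        (contDiff_id.sub contDiff_const) hq
      exact (contDiff_const.mul (contDiff_const.sub this)).contDiffOn)
    hV
    (by
      rw [hflux]
      have : ContDiff ℝ 1 (fun y : EuclideanSpace ℝ (Fin N) => (-(μ' / N)) • (y - x₀)) := by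
        fun_prop
      exact this.contDiffOn)
    (by
      intro x hx
      rw [hflux, pdiv_smul_sub_const, neg_mul, div_mul_cancel₀ _ hN0.ne']
      linarith [hdiv x hx])
    (by
      intro x hx hxr
      rw [mem_closedBall, dist_eq_norm, not_le] at hxr
      refine le_trans (mul_nonpos_of_nonneg_of_nonpos (by positivity) ?_) (hv0 x hx)
      exact sub_nonpos.2 (Real.rpow_le_rpow hr.le hxr.le (by linarith)))
    x₀ (mem_ball_self (hr.trans hrR))
  have hq0 : p / (p - 1) ≠ 0 := by linarith
  simpa [Real.zero_rpow hq0] using h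

end Divergence

lemma pdiv_inv_smul_flux_le {N : ℕ} {p : ℝ} {f : ℝ → ℝ} {u : EuclideanSpace ℝ (Fin N) → ℝ}
    {x : EuclideanSpace ℝ (Fin N)} (hpos : 0 < f (u x)) (hf : DifferentiableAt ℝ f (u x))
    (hf' : 0 ≤ deriv f (u x)) (hu : DifferentiableAt ℝ u x)
    (hV : DifferentiableAt ℝ (flux p u) x) :
    pdiv (fun y => (f (u y))⁻¹ • flux p u y) x ≤ (f (u x))⁻¹ * pdiv (flux p u) x := by
  have h : HasFDerivAt (fun y => (f (u y))⁻¹)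
      ((-deriv f (u x) / f (u x) ^ 2) • fderiv ℝ u x) x :=
    (hf.hasDerivAt.inv hpos.ne').comp_hasFDerivAt x hu.hasFDerivAt
  rw [pdiv_smul h.differentiableAt hV, h.fderiv, smul_apply, ← toDual_gradient,
    InnerProductSpace.toDual_apply_apply, flux, inner_smul_right, real_inner_self_eq_norm_sq,
    smul_eq_mul, neg_div, neg_mul]
  have : 0 ≤ deriv f (u x) / f (u x) ^ 2 * (‖gradient u x‖ ^ (p - 2) * ‖gradient u x‖ ^ 2) := by
    positivity
  linarith

/-- The primitive `t ↦ ∫₀ᵗ f ^ s` is `C¹` on an open set of positive reals on which `f > 0`. -/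
lemma hasDerivAt_contDiffOn_primitive_rpow {f : ℝ → ℝ} {I : Set ℝ} {s : ℝ} (hI : IsOpen I)
    (hpos : ∀ t ∈ I, 0 < f t) (hf : ContinuousOn f I) (hI0 : ∀ t ∈ I, 0 < t)
    (hint : ∀ t ∈ I, IntegrableOn (fun a => f a ^ s) (Ioo 0 t)) :
    (∀ t ∈ I, HasDerivAt (fun t => ∫ a in (0 : ℝ)..t, f a ^ s) (f t ^ s) t) ∧
      ContDiffOn ℝ 1 (fun t => ∫ a in (0 : ℝ)..t, f a ^ s) I := by
  have hc : ContinuousOn (fun a => f a ^ s) I := hf.rpow_const fun t ht => Or.inl (hpos t ht).ne'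
  have hd : ∀ t ∈ I, HasDerivAt (fun t => ∫ a in (0 : ℝ)..t, f a ^ s) (f t ^ s) t := fun t ht =>
    intervalIntegral.integral_hasDerivAt_right
      ((intervalIntegrable_iff_integrableOn_Ioo_of_le (hI0 t ht).le).2 (hint t ht))
      (hc.stronglyMeasurableAtFilter hI t ht) (hc.continuousAt (hI.mem_nhds ht))
  refine ⟨hd, ?_⟩
  rw [show (1 : WithTop ℕ∞) = 0 + 1 by simp, contDiffOn_succ_iff_deriv_of_isOpen hI]
  refine ⟨fun t ht => (hd t ht).differentiableAt.differentiableWithinAt, by simp, ?_⟩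
  rw [contDiffOn_zero]
  exact hc.congr fun t ht => (hd t ht).deriv

/-- Theorem 4.1 (i): nonexistence of positive `C¹` supersolutions of
`-Δ_p u ≥ λ ρ(x) f(u)` on a bounded open set `Ω`, vanishing on `∂Ω`, whenever
`λ > (p/(p-1))^(p-1) N ‖F‖_∞^(p-1) / S` with `‖F‖_∞ = ∫₀^{a_f} f(s)^(-1/(p-1)) ds`
(encoded as `sSup` of the range of `F`, assumed bounded) and
`S = sup_{x ∈ Ω} ρ_x(d_Ω(x)) d_Ω(x)^p`, assumed to satisfy `0 < S < ∞`. -/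
theorem stmt14 {N : ℕ} (hN : 1 ≤ N) (p : ℝ) (hp : 1 < p)
    (Ω : Set (EuclideanSpace ℝ (Fin N))) (hΩo : IsOpen Ω) (hΩb : Bornology.IsBounded Ω)
    (ρ : EuclideanSpace ℝ (Fin N) → ℝ)
    (hρ0 : ∀ x ∈ Ω, 0 ≤ ρ x) (hρb : BddAbove (ρ '' Ω))
    (af : EReal) (haf : 0 < af) (f : ℝ → ℝ)
    (hf0 : ∀ t : ℝ, 0 ≤ t → (t : EReal) < af → 0 ≤ f t)
    (hfpos : ∀ t : ℝ, 0 < t → (t : EReal) < af → 0 < f t)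
    (hmono : MonotoneOn f {t : ℝ | 0 ≤ t ∧ (t : EReal) < af})
    (hreg : ContDiffOn ℝ 1 f {t : ℝ | 0 ≤ t ∧ (t : EReal) < af})
    (hint : ∀ a : ℝ, 0 < a → (a : EReal) < af →
      IntegrableOn (fun s => f s ^ (-(1 / (p - 1)))) (Ioo 0 a))
    (F : ℝ → ℝ) (hF : F = fun t => ∫ s in (0:ℝ)..t, f s ^ (-(1 / (p - 1))))
    (hFbdd : BddAbove (F '' {t : ℝ | 0 ≤ t ∧ (t : EReal) < af}))
    (hSbdd : BddAbove
      ((fun x => sInf (ρ '' ball x (infDist x Ωᶜ)) * infDist x Ωᶜ ^ p) '' Ω))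
    (hSpos : 0 < sSup ((fun x => sInf (ρ '' ball x (infDist x Ωᶜ)) * infDist x Ωᶜ ^ p) '' Ω))
    (lam : ℝ)
    (hlam : (p / (p - 1)) ^ (p - 1) * (N : ℝ) *
        sSup (F '' {t : ℝ | 0 ≤ t ∧ (t : EReal) < af}) ^ (p - 1) /
        sSup ((fun x => sInf (ρ '' ball x (infDist x Ωᶜ)) * infDist x Ωᶜ ^ p) '' Ω)
      < lam) :
    ¬ ∃ u : EuclideanSpace ℝ (Fin N) → ℝ,
        ContinuousOn u (closure Ω) ∧ ContDiffOn ℝ 1 u Ω ∧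
        (∀ x ∈ Ω, 0 < u x ∧ ((u x : ℝ) : EReal) < af) ∧
        (∀ x ∈ frontier Ω, u x = 0) ∧
        ContDiffOn ℝ 1 (flux p u) Ω ∧
        ∀ x ∈ Ω, pdiv (flux p u) x ≤ -(lam * ρ x * f (u x)) := by
  rintro ⟨u, -, hu, hurange, -, hflux, hsuper⟩
  have hp1 : 0 < p - 1 := by linarith
  have hN0 : (0 : ℝ) < N := by exact_mod_cast hN
  set A : Set ℝ := {t : ℝ | 0 ≤ t ∧ (t : EReal) < af} with hA
  set Fs : ℝ := sSup (F '' A) with hFs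
  set I : Set ℝ := {t : ℝ | 0 < t ∧ (t : EReal) < af} with hI
  have hIo : IsOpen I :=
    (isOpen_lt continuous_const continuous_id).inter
      (isOpen_lt continuous_coe_real_ereal continuous_const)
  have hIA : I ⊆ A := fun t ht => ⟨ht.1.le, ht.2⟩
  have hA0 : (0 : ℝ) ∈ A := ⟨le_rfl, by simpa using haf⟩
  have hFs0 : 0 ≤ Fs := le_csSup hFbdd ⟨0, hA0, by simp [hF]⟩
  have hregI : ContDiffOn ℝ 1 f I := hreg.mono hIA
  obtain ⟨hFderiv, hFI⟩ := hasDerivAt_contDiffOn_primitive_rpow hIo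
    (fun t ht => hfpos t ht.1 ht.2) hregI.continuousOn (fun t ht => ht.1)
    (fun t ht => hint t ht.1 ht.2)
  rw [← hF] at hFI
  have hmaps : MapsTo u Ω I := fun x hx => hurange x hx
  have hF0 : ∀ t ∈ A, 0 ≤ F t := fun t ht => by
    rw [hF]
    exact intervalIntegral.integral_nonneg ht.1 fun s hs =>
      Real.rpow_nonneg (hf0 s hs.1 (lt_of_le_of_lt (EReal.coe_le_coe_iff.2 hs.2) ht.2)) _
  have hflux_eq : ∀ x ∈ Ω, flux p (fun y => F (u y)) x = (f (u x))⁻¹ • flux p u x := by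
    intro x hx
    have hfx : 0 < f (u x) := hfpos _ (hmaps hx).1 (hmaps hx).2
    rw [flux_comp (Real.rpow_pos_of_pos hfx (-(1 / (p - 1)))) (hF ▸ hFderiv _ (hmaps hx))
      ((hu.contDiffAt (hΩo.mem_nhds hx)).differentiableAt one_ne_zero),
      ← Real.rpow_mul hfx.le, neg_mul, one_div_mul_cancel hp1.ne', Real.rpow_neg_one]
  have hvC : ContDiffOn ℝ 1 (fun y => F (u y)) Ω := hFI.comp hu hmaps
  have hVC : ContDiffOn ℝ 1 (flux p (fun y => F (u y))) Ω :=
    (((hregI.comp hu hmaps).inv fun x hx =>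
      (hfpos _ (hmaps hx).1 (hmaps hx).2).ne').smul hflux).congr hflux_eq
  have hvdiv : ∀ x ∈ Ω, pdiv (flux p (fun y => F (u y))) x ≤ -(lam * ρ x) := by
    intro x hx
    have hn := hΩo.mem_nhds hx
    have hfx : 0 < f (u x) := hfpos _ (hmaps hx).1 (hmaps hx).2
    have hfd := (hregI.contDiffAt (hIo.mem_nhds (hmaps hx))).differentiableAt one_ne_zero
    have hfd0 : 0 ≤ deriv f (u x) := by
      rw [← derivWithin_of_mem_nhds (hIo.mem_nhds (hmaps hx))]
      exact (hmono.mono hIA).derivWithin_nonneg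
    have hev : flux p (fun y => F (u y)) =ᶠ[𝓝 x] fun y => (f (u y))⁻¹ • flux p u y :=
      Filter.eventuallyEq_of_mem hn hflux_eq
    have e1 : pdiv (flux p (fun y => F (u y))) x
        = pdiv (fun y => (f (u y))⁻¹ • flux p u y) x := by
      simp only [pdiv, hev.fderiv_eq]
    rw [e1]
    refine (pdiv_inv_smul_flux_le hfx hfd hfd0
      ((hu.contDiffAt hn).differentiableAt one_ne_zero)
      ((hflux.contDiffAt hn).differentiableAt one_ne_zero)).trans ?_
    rw [inv_mul_le_iff₀ hfx]
    linarith [hsuper x hx]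
  set T : Set ℝ := (fun x => sInf (ρ '' ball x (infDist x Ωᶜ)) * infDist x Ωᶜ ^ p) '' Ω with hT
  have hTne : T.Nonempty := by
    by_contra h
    rw [not_nonempty_iff_eq_empty] at h
    rw [h, Real.sSup_empty] at hSpos
    exact lt_irrefl _ hSpos
  have hK0 : 0 ≤ (p / (p - 1)) ^ (p - 1) * (N : ℝ) * Fs ^ (p - 1) := by positivity
  have hlam0 : 0 < lam := lt_of_le_of_lt (by positivity) hlam
  rw [div_lt_iff₀ hSpos, mul_comm lam, ← div_lt_iff₀ hlam0] at hlam
  obtain ⟨_, ⟨x, hx, rfl⟩, hKx⟩ := exists_lt_of_lt_csSup hTne hlam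
  rw [div_lt_iff₀ hlam0] at hKx
  set R := infDist x Ωᶜ with hR
  set ρ₀ := sInf (ρ '' ball x R) with hρ₀
  have hBΩ : ball x R ⊆ Ω := ball_infDist_compl_subset
  have hprod : 0 < ρ₀ * R ^ p := pos_of_mul_pos_left (hK0.trans_lt hKx) hlam0.le
  have hR0 : 0 < R := by
    refine lt_of_le_of_ne infDist_nonneg fun h => ?_
    rw [← h, Real.zero_rpow (by linarith), mul_zero] at hprod
    exact lt_irrefl _ hprod
  have hρ₀0 : 0 < ρ₀ := pos_of_mul_pos_left hprod (by positivity)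
  have hρ₀le : ∀ y ∈ ball x R, ρ₀ ≤ ρ y := fun y hy =>
    csInf_le ⟨0, by rintro _ ⟨z, hz, rfl⟩; exact hρ0 z (hBΩ hz)⟩ (mem_image_of_mem ρ hy)
  obtain ⟨t, htK, ht0, ht1⟩ : ∃ t : ℝ, (p / (p - 1)) ^ (p - 1) * (N : ℝ) * Fs ^ (p - 1)
      < t * (lam * ρ₀) * (t * R) ^ p ∧ 0 < t ∧ t < 1 := by
    have hcont : ContinuousAt (fun t : ℝ => t * (lam * ρ₀) * (t * R) ^ p) 1 := by
      have h2 : ContinuousAt (fun t : ℝ => (t * R) ^ p) 1 :=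
        (continuousAt_id.mul continuousAt_const).rpow_const (Or.inr (by linarith))
      exact (continuousAt_id.mul continuousAt_const).mul h2
    have h1 := hcont.eventually_const_lt (u := (p / (p - 1)) ^ (p - 1) * (N : ℝ) * Fs ^ (p - 1))
      (by simp only [one_mul]; linarith)
    have h2 : ∀ᶠ t : ℝ in 𝓝[<] 1, 0 < t := nhdsWithin_le_nhds (Ioi_mem_nhds one_pos)
    exact ((h1.filter_mono nhdsWithin_le_nhds).and (h2.and self_mem_nhdsWithin)).exists
  have hcenter := le_center_of_pdiv_flux_le hp hN (x₀ := x) (r := t * R) (R := R)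
    (μ := lam * ρ₀) (μ' := t * (lam * ρ₀)) (v := fun y => F (u y)) (by positivity)
    (by nlinarith) (by positivity) (by nlinarith [mul_pos hlam0 hρ₀0]) (hvC.mono hBΩ)
    (hVC.mono hBΩ) (fun y hy => hF0 _ (hIA (hmaps (hBΩ hy))))
    (fun y hy => (hvdiv y (hBΩ hy)).trans
      (neg_le_neg (mul_le_mul_of_nonneg_left (hρ₀le y hy) hlam0.le)))
  have hle := hcenter.trans (le_csSup hFbdd (mem_image_of_mem F (hIA (hmaps hx))))
  have hpow := Real.rpow_le_rpow (by positivity) hle hp1.le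
  have htR : 0 ≤ t * R := by positivity
  have hm0 : 0 ≤ t * (lam * ρ₀) / N := by positivity
  have hc0 : 0 ≤ (p - 1) / p := by positivity
  rw [Real.mul_rpow (by positivity) (by positivity), Real.mul_rpow (by positivity) (by positivity),
    ← Real.rpow_mul hm0, ← Real.rpow_mul htR, one_div_mul_cancel hp1.ne',
    div_mul_cancel₀ _ hp1.ne', Real.rpow_one] at hpow
  have hinv : (p / (p - 1)) ^ (p - 1) * ((p - 1) / p) ^ (p - 1) = 1 := by
    rw [← Real.mul_rpow (by positivity) hc0, div_mul_div_cancel₀' (by positivity),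
      div_self (by positivity), Real.one_rpow]
  have hfin := mul_le_mul_of_nonneg_left hpow
    (show 0 ≤ (p / (p - 1)) ^ (p - 1) * (N : ℝ) by positivity)
  have hcalc : (p / (p - 1)) ^ (p - 1) * (N : ℝ) *
      (t * (lam * ρ₀) / N * ((p - 1) / p) ^ (p - 1) * (t * R) ^ p)
      = ((p / (p - 1)) ^ (p - 1) * ((p - 1) / p) ^ (p - 1)) * (N / N) *
        (t * (lam * ρ₀) * (t * R) ^ p) := by ring
  rw [hcalc, hinv, div_self hN0.ne', one_mul, one_mul] at hfin
  exact absurd hfin (not_le.2 htK)
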